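/- Let 0 < q < 1, δ ∈ {1,2}, ν ∈ ℝ and σ > 0. Define g(s) = q^{−δs²/4 + (2+δ)s/2} Γ_{q²}((s+iν)/2) Γ_{q²}((s−iν)/2) and G(x) = (1/2π) ∫_{−∞}^{∞} g(σ + it) x^{−(σ+it)} dt for x > 0. Then: (i) the integral converges absolutely for every x > 0 and is independent of the choice of σ > 0; (ii) G satisfies the q-difference equation G(q^{−1}x) − (q^{iν} + q^{−iν}) G(x) + G(qx) − q^{−2δ}(1−q²)² x² G(q^{1−δ}x) = 0 for all x > 0. -/

import Mathlib

/-- The infinite q-Pochhammer symbol `(a;Q)_∞ = ∏_{j≥0} (1 − a Q^j)`. -/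
noncomputable def qPochInf (Q a : ℂ) : ℂ :=
  ∏' j : ℕ, (1 - a * Q ^ j)

/-- `q^w = exp(w ln q)` for real `q > 0` and complex `w`. -/
noncomputable def qpow (q : ℝ) (w : ℂ) : ℂ := Complex.exp (w * (Real.log q : ℂ))

/-- The q²-Gamma function `Γ_{q²}(x) = (q²;q²)_∞(1−q²)^{1−x}/(q^{2x};q²)_∞`. -/
noncomputable def qGamma2 (q : ℝ) (x : ℂ) : ℂ :=
  qPochInf ((q : ℂ) ^ 2) ((q : ℂ) ^ 2)
    * Complex.exp ((1 - x) * (Real.log (1 - q ^ 2) : ℂ))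
    / qPochInf ((q : ℂ) ^ 2) (qpow q (2 * x))

/-- The Mellin-space integrand
`g(s) = q^{−δs²/4 + (2+δ)s/2} Γ_{q²}((s+iν)/2) Γ_{q²}((s−iν)/2)`. -/
noncomputable def gMB (q : ℝ) (δ : ℕ) (ν : ℝ) (s : ℂ) : ℂ :=
  qpow q (-((δ : ℂ) * s ^ 2 / 4) + (2 + (δ : ℂ)) * s / 2)
    * qGamma2 q ((s + Complex.I * ν) / 2) * qGamma2 q ((s - Complex.I * ν) / 2)

/-- The Mellin–Barnes integral
`G(x) = (1/2π) ∫_ℝ g(σ+it) x^{−(σ+it)} dt`. -/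
noncomputable def GMB (q : ℝ) (δ : ℕ) (ν : ℝ) (σ : ℝ) (x : ℝ) : ℂ :=
  (1 / (2 * (Real.pi : ℂ))) *
    ∫ t : ℝ, gMB q δ ν ((σ : ℂ) + Complex.I * t)
      * Complex.exp (-((σ : ℂ) + Complex.I * t) * (Real.log x : ℂ))


lemma qp_summable {Q : ℂ} (hQ : ‖Q‖ < 1) (a : ℂ) : Summable (fun j : ℕ => ‖-(a * Q ^ j)‖) := by
  simp only [norm_neg, norm_mul, norm_pow]
  exact (summable_geometric_of_lt_one (norm_nonneg _) hQ).mul_left _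

lemma qp_multipliable {Q : ℂ} (hQ : ‖Q‖ < 1) (a : ℂ) :
    Multipliable (fun j : ℕ => 1 - a * Q ^ j) := by
  simpa [sub_eq_add_neg] using multipliable_one_add_of_summable (qp_summable hQ a)

lemma qp_rec {Q : ℂ} (hQ : ‖Q‖ < 1) (a : ℂ) :
    qPochInf Q a = (1 - a) * qPochInf Q (a * Q) := by
  unfold qPochInf
  rw [tprod_eq_zero_mul' (f := fun j : ℕ => 1 - a * Q ^ j)]
  · simp [pow_succ', mul_assoc]
  · simpa [pow_succ', mul_assoc] using qp_multipliable hQ (a * Q)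

lemma qp_ne_zero {Q : ℂ} (hQ : ‖Q‖ < 1) {a : ℂ} (ha : ‖a‖ < 1) : qPochInf Q a ≠ 0 := by
  unfold qPochInf
  simp only [sub_eq_add_neg]
  refine tprod_one_add_ne_zero_of_summable (f := fun j : ℕ => -(a * Q ^ j)) ?_ (qp_summable hQ a)
  intro j h
  have h1 : a * Q ^ j = 1 := by linear_combination -h
  have h2 : ‖a * Q ^ j‖ < 1 := by
    rw [norm_mul, norm_pow]
    calc ‖a‖ * ‖Q‖ ^ j ≤ ‖a‖ * 1 := by
          gcongr
          exact pow_le_one₀ (norm_nonneg _) hQ.le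
      _ < 1 := by linarith
  rw [h1] at h2
  simp at h2

lemma qp_diff {Q : ℂ} (hQ : ‖Q‖ < 1) :
    DifferentiableOn ℂ (qPochInf Q) (Metric.ball 0 1) := by
  have h : HasProdLocallyUniformlyOn (fun (j : ℕ) (a : ℂ) => 1 + -(a * Q ^ j))
      (fun a => ∏' j : ℕ, (1 + -(a * Q ^ j))) (Metric.ball 0 1) := by
    refine Summable.hasProdLocallyUniformlyOn_nat_one_add Metric.isOpen_ball
      (summable_geometric_of_lt_one (norm_nonneg _) hQ) (.of_forall fun n x hx => ?_)
      (fun n => by fun_prop)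
    rw [norm_neg, norm_mul, norm_pow]
    have : ‖x‖ ≤ 1 := by simpa using (mem_ball_zero_iff.1 hx).le
    exact mul_le_of_le_one_left (by positivity) this
  have := h.differentiableOn (.of_forall fun _ => by
    simpa [Finset.prod_fn] using DifferentiableOn.finsetProd (fun _ _ => by fun_prop))
    Metric.isOpen_ball
  refine this.congr fun a _ => ?_
  simp [qPochInf, sub_eq_add_neg]

lemma qp_lower {Q : ℂ} (hQ : ‖Q‖ < 1) {r : ℝ} (hr : r < 1) :
    ∃ c > 0, ∀ a : ℂ, ‖a‖ ≤ r → c ≤ ‖qPochInf Q a‖ := by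
  rcases lt_or_ge r 0 with h0 | h0
  · exact ⟨1, one_pos, fun a ha => absurd (norm_nonneg a) (by linarith)⟩
  have hsub : Metric.closedBall (0 : ℂ) r ⊆ Metric.ball 0 1 := Metric.closedBall_subset_ball hr
  obtain ⟨a0, ha0, hmin⟩ := (isCompact_closedBall (0 : ℂ) r).exists_isMinOn
    ⟨0, by simpa using h0⟩ ((qp_diff hQ).continuousOn.mono hsub).norm
  refine ⟨‖qPochInf Q a0‖, norm_pos_iff.2 (qp_ne_zero hQ ?_), fun a ha => hmin ?_⟩
  · simpa using hsub ha0
  · simpa using ha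

lemma qpow_norm (q : ℝ) (w : ℂ) : ‖qpow q w‖ = Real.exp (w.re * Real.log q) := by
  simp [qpow, Complex.norm_exp]

lemma qpow_add (q : ℝ) (v w : ℂ) : qpow q (v + w) = qpow q v * qpow q w := by
  simp [qpow, add_mul, Complex.exp_add]

lemma qpow_two {q : ℝ} (hq : 0 < q) : qpow q 2 = (q : ℂ) ^ 2 := by
  simp only [qpow]
  rw [show (2 : ℂ) * (Real.log q : ℂ) = Real.log q + Real.log q by ring, Complex.exp_add,
    ← Complex.ofReal_exp, Real.exp_log hq]
  ring

lemma norm_q2 {q : ℝ} (hq0 : 0 < q) (hq1 : q < 1) : ‖(q : ℂ) ^ 2‖ < 1 := by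
  rw [norm_pow, Complex.norm_real, Real.norm_eq_abs, abs_of_pos hq0]
  exact pow_lt_one₀ hq0.le hq1 (by norm_num)

lemma qpow_norm_lt {q : ℝ} (hq0 : 0 < q) (hq1 : q < 1) {x : ℂ} (hx : 0 < x.re) :
    ‖qpow q (2 * x)‖ < 1 := by
  rw [qpow_norm, Real.exp_lt_one_iff]
  have := Real.log_neg hq0 hq1
  have h2 : (2 * x).re = 2 * x.re := by simp
  rw [h2]
  nlinarith

lemma qGamma2_diff {q : ℝ} (hq0 : 0 < q) (hq1 : q < 1) :
    DifferentiableOn ℂ (qGamma2 q) {x | 0 < x.re} := by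
  unfold qGamma2
  refine DifferentiableOn.div (by fun_prop) ?_ ?_
  · refine (qp_diff (norm_q2 hq0 hq1)).comp (t := Metric.ball 0 1) ?_ ?_
    · unfold qpow
      fun_prop
    · intro x hx
      simpa using qpow_norm_lt hq0 hq1 hx
  · intro x hx
    exact qp_ne_zero (norm_q2 hq0 hq1) (qpow_norm_lt hq0 hq1 hx)

lemma qGamma2_bound {q : ℝ} (hq0 : 0 < q) (hq1 : q < 1) {a b : ℝ} (ha : 0 < a) :
    ∃ C, 0 ≤ C ∧ ∀ x : ℂ, a ≤ x.re → x.re ≤ b → ‖qGamma2 q x‖ ≤ C := by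
  have hl := Real.log_neg hq0 hq1
  obtain ⟨c, hc, hcb⟩ := qp_lower (norm_q2 hq0 hq1) (r := Real.exp (2 * a * Real.log q))
    (by rw [Real.exp_lt_one_iff]; nlinarith)
  refine ⟨‖qPochInf ((q : ℂ) ^ 2) ((q : ℂ) ^ 2)‖ *
    Real.exp ((1 + b) * |Real.log (1 - q ^ 2)|) / c, by positivity, fun x h1 h2 => ?_⟩
  unfold qGamma2
  rw [norm_div, norm_mul, Complex.norm_exp]
  gcongr
  · rw [Complex.re_mul_ofReal]
    have h3 : |1 - x.re| ≤ 1 + b := abs_le.2 ⟨by linarith, by linarith⟩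
    calc (1 - x).re * Real.log (1 - q ^ 2) ≤ |(1 - x.re) * Real.log (1 - q ^ 2)| := by
          simpa using le_abs_self ((1 - x.re) * Real.log (1 - q ^ 2))
      _ = |1 - x.re| * |Real.log (1 - q ^ 2)| := abs_mul _ _
      _ ≤ _ := by gcongr
  · apply hcb
    rw [qpow_norm]
    apply Real.exp_le_exp.2
    have : (2 * x).re = 2 * x.re := by simp
    rw [this]
    nlinarith

lemma qGamma2_rec {q : ℝ} (hq0 : 0 < q) (hq1 : q < 1) {x : ℂ} (hx : 0 < x.re) :
    (1 - (q : ℂ) ^ 2) * qGamma2 q (x + 1) = (1 - qpow q (2 * x)) * qGamma2 q x := by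
  have hQ := norm_q2 hq0 hq1
  have e1 : qpow q (2 * (x + 1)) = qpow q (2 * x) * (q : ℂ) ^ 2 := by
    rw [← qpow_two hq0, ← qpow_add]; ring_nf
  have hx1 : 0 < (x + 1).re := by simp; linarith
  have n1 := qp_ne_zero hQ (qpow_norm_lt hq0 hq1 hx1)
  have n2 := qp_ne_zero hQ (qpow_norm_lt hq0 hq1 hx)
  have r := qp_rec hQ (qpow q (2 * x))
  rw [← e1] at r
  have hpos : 0 < 1 - q ^ 2 := by nlinarith
  have e2 : Complex.exp ((1 - x) * (Real.log (1 - q ^ 2) : ℂ)) =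
      (1 - (q : ℂ) ^ 2) * Complex.exp ((1 - (x + 1)) * (Real.log (1 - q ^ 2) : ℂ)) := by
    rw [show (1 - x) * (Real.log (1 - q ^ 2) : ℂ) = (Real.log (1 - q ^ 2) : ℂ) +
      (1 - (x + 1)) * (Real.log (1 - q ^ 2) : ℂ) by ring, Complex.exp_add,
      ← Complex.ofReal_exp, Real.exp_log hpos]
    push_cast
    ring
  have n3 : (1 - qpow q (2 * x)) ≠ 0 := by
    intro h
    rw [h, zero_mul] at r
    exact n2 r
  unfold qGamma2
  rw [e2, r]
  generalize qPochInf ((q : ℂ) ^ 2) (qpow q (2 * (x + 1))) = A at *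
  generalize 1 - qpow q (2 * x) = B at *
  field_simp

/-- The full integrand as a function of `s`, with `L = log x`. -/
noncomputable def fMB (q : ℝ) (δ : ℕ) (ν : ℝ) (L : ℝ) (s : ℂ) : ℂ :=
  gMB q δ ν s * Complex.exp (-s * (L : ℂ))

lemma fMB_diff {q : ℝ} (hq0 : 0 < q) (hq1 : q < 1) (δ : ℕ) (ν L : ℝ) :
    DifferentiableOn ℂ (fMB q δ ν L) {s | 0 < s.re} := by
  unfold fMB gMB
  refine DifferentiableOn.mul (DifferentiableOn.mul (DifferentiableOn.mul ?_ ?_) ?_) (by fun_prop)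
  · unfold qpow
    fun_prop
  · refine (qGamma2_diff hq0 hq1).comp (f := fun s : ℂ => (s + Complex.I * ν) / 2)
      (by fun_prop) ?_
    intro s hs
    simpa using hs
  · refine (qGamma2_diff hq0 hq1).comp (f := fun s : ℂ => (s - Complex.I * ν) / 2)
      (by fun_prop) ?_
    intro s hs
    simpa using hs

lemma fMB_bound {q : ℝ} (hq0 : 0 < q) (hq1 : q < 1) {δ : ℕ} (hδ : 0 < δ) (ν L : ℝ)
    {a b : ℝ} (ha : 0 < a) :
    ∃ C c, 0 ≤ C ∧ 0 < c ∧ ∀ s : ℂ, a ≤ s.re → s.re ≤ b →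
      ‖fMB q δ ν L s‖ ≤ C * Real.exp (-c * s.im ^ 2) := by
  have hl := Real.log_neg hq0 hq1
  have hd : (0 : ℝ) < δ := by exact_mod_cast hδ
  obtain ⟨C, hC, hCb⟩ := qGamma2_bound hq0 hq1 (a := a / 2) (b := b / 2) (by positivity)
  refine ⟨Real.exp (δ * b ^ 2 / 4 * (-Real.log q) + b * |L|) * (C * C),
    δ / 4 * (-Real.log q), by positivity, mul_pos (by positivity) (by linarith), fun s h1 h2 => ?_⟩
  have hb1 := hCb ((s + Complex.I * ν) / 2) (by simp; linarith) (by simp; linarith)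
  have hb2 := hCb ((s - Complex.I * ν) / 2) (by simp; linarith) (by simp; linarith)
  have hE : ‖qpow q (-((δ : ℂ) * s ^ 2 / 4) + (2 + (δ : ℂ)) * s / 2)‖ *
      ‖Complex.exp (-s * (L : ℂ))‖ ≤
      Real.exp (δ * b ^ 2 / 4 * (-Real.log q) + b * |L|) *
        Real.exp (-(δ / 4 * (-Real.log q)) * s.im ^ 2) := by
    rw [qpow_norm, Complex.norm_exp, ← Real.exp_add, ← Real.exp_add]
    apply Real.exp_le_exp.2
    have e1 : (-((δ : ℂ) * s ^ 2 / 4) + (2 + (δ : ℂ)) * s / 2).re =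
        -(δ * (s.re ^ 2 - s.im ^ 2) / 4) + (2 + δ) * s.re / 2 := by
      simp [pow_two]
    rw [e1, Complex.re_mul_ofReal, Complex.neg_re]
    have i1 : -s.re * L ≤ b * |L| := by
      calc -s.re * L ≤ |(-s.re) * L| := le_abs_self _
        _ = s.re * |L| := by rw [abs_mul, abs_neg, abs_of_pos (by linarith)]
        _ ≤ _ := by gcongr
    have i2 : (2 + (δ : ℝ)) * s.re / 2 * Real.log q ≤ 0 :=
      mul_nonpos_of_nonneg_of_nonpos (by have : 0 < s.re := by linarith
                                         positivity) hl.le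
    have i3 : (δ : ℝ) * s.re ^ 2 / 4 * (-Real.log q) ≤ δ * b ^ 2 / 4 * (-Real.log q) := by
      have : 0 ≤ s.re := by linarith
      have : 0 ≤ -Real.log q := by linarith
      gcongr
    nlinarith
  unfold fMB gMB
  rw [norm_mul, norm_mul, norm_mul]
  calc _ = (‖qpow q (-((δ : ℂ) * s ^ 2 / 4) + (2 + (δ : ℂ)) * s / 2)‖ *
      ‖Complex.exp (-s * (L : ℂ))‖) * (‖qGamma2 q ((s + Complex.I * ν) / 2)‖ *
        ‖qGamma2 q ((s - Complex.I * ν) / 2)‖) := by ring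
    _ ≤ (Real.exp (δ * b ^ 2 / 4 * (-Real.log q) + b * |L|) *
        Real.exp (-(δ / 4 * (-Real.log q)) * s.im ^ 2)) * (C * C) := by gcongr
    _ = _ := by ring

lemma line_integrable {f : ℂ → ℂ} {a C c : ℝ} (ha : 0 < a) (hc : 0 < c)
    (hf : DifferentiableOn ℂ f {s | 0 < s.re})
    (hb : ∀ s : ℂ, s.re = a → ‖f s‖ ≤ C * Real.exp (-c * s.im ^ 2)) :
    MeasureTheory.Integrable (fun t : ℝ => f ((a : ℂ) + Complex.I * t)) := by
  refine ((integrable_exp_neg_mul_sq hc).const_mul C).mono' ?_ (.of_forall fun t => ?_)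
  · refine Continuous.aestronglyMeasurable ?_
    refine hf.continuousOn.comp_continuous (by fun_prop) fun t => ?_
    simpa using ha
  · simpa using hb ((a : ℂ) + Complex.I * t) (by simp)

open Filter Topology in
lemma line_shift {f : ℂ → ℂ} {a b C c : ℝ} (ha : 0 < a) (hab : a ≤ b) (hc : 0 < c)
    (hf : DifferentiableOn ℂ f {s | 0 < s.re})
    (hbd : ∀ s : ℂ, a ≤ s.re → s.re ≤ b → ‖f s‖ ≤ C * Real.exp (-c * s.im ^ 2)) :
    ∫ t : ℝ, f ((a : ℂ) + Complex.I * t) = ∫ t : ℝ, f ((b : ℂ) + Complex.I * t) := by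
  have ia := line_integrable ha hc hf (fun s hs => hbd s hs.ge (hs.le.trans hab))
  have ib := line_integrable (ha.trans_le hab) hc hf (fun s hs => hbd s (hab.trans hs.ge) hs.le)
  have ta := MeasureTheory.intervalIntegral_tendsto_integral ia tendsto_neg_atTop_atBot tendsto_id
  have tb := MeasureTheory.intervalIntegral_tendsto_integral ib tendsto_neg_atTop_atBot tendsto_id
  have hgauss : Tendsto (fun T : ℝ => C * Real.exp (-c * T ^ 2) * |b - a|) atTop (𝓝 0) := by
    have : Tendsto (fun T : ℝ => Real.exp (-c * T ^ 2)) atTop (𝓝 0) := by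
      refine Real.tendsto_exp_atBot.comp ?_
      exact (tendsto_pow_atTop (by norm_num)).const_mul_atTop_of_neg (by linarith)
    simpa using (this.const_mul C).mul_const |b - a|
  have hside : ∀ e : ℝ → ℝ, (∀ T, e T ^ 2 = T ^ 2) →
      Tendsto (fun T : ℝ => ∫ x in a..b, f (x + (e T : ℝ) * Complex.I)) atTop (𝓝 0) := by
    intro e he
    refine squeeze_zero_norm (fun T => ?_) hgauss
    refine intervalIntegral.norm_integral_le_of_norm_le_const fun x hx => ?_
    rw [Set.uIoc_of_le hab] at hx
    have := hbd (x + (e T : ℝ) * Complex.I) (by simpa using hx.1.le) (by simpa using hx.2)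
    simpa [he] using this
  have s1 := hside (fun T => -T) (fun T => by ring)
  have s2 := hside (fun T => T) (fun T => rfl)
  have key : ∀ T : ℝ, (∫ t in (-T)..T, f ((b : ℂ) + Complex.I * t)) -
      (∫ t in (-T)..T, f ((a : ℂ) + Complex.I * t)) =
      Complex.I * ((∫ x in a..b, f (x + ((-T : ℝ) : ℂ) * Complex.I)) -
        ∫ x in a..b, f (x + (T : ℂ) * Complex.I)) := by
    intro T
    have h := Complex.integral_boundary_rect_eq_zero_of_differentiableOn f ⟨a, -T⟩ ⟨b, T⟩
      (hf.mono (by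
        intro s hs
        have := hs.1
        simp only [Set.mem_preimage, Set.uIcc_of_le hab] at this
        exact ha.trans_le this.1))
    simp only [smul_eq_mul] at h
    simp only [mul_comm Complex.I] at h ⊢
    linear_combination (-Complex.I) * h + ((∫ t in (-T)..T, f ((b : ℂ) + t * Complex.I)) -
      (∫ t in (-T)..T, f ((a : ℂ) + t * Complex.I))) * Complex.I_sq
  have l1 := tb.sub ta
  have l2 := (s1.sub s2).const_mul Complex.I
  have := tendsto_nhds_unique (l1.congr fun T => key T) l2
  simp only [sub_self, mul_zero] at this
  exact (sub_eq_zero.1 this).symm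

lemma fMB_shift {q : ℝ} (hq0 : 0 < q) (hq1 : q < 1) {δ : ℕ} (hδ : 0 < δ) (ν L : ℝ)
    {a b : ℝ} (ha : 0 < a) (hb : 0 < b) :
    ∫ t : ℝ, fMB q δ ν L ((a : ℂ) + Complex.I * t) =
      ∫ t : ℝ, fMB q δ ν L ((b : ℂ) + Complex.I * t) := by
  rcases le_total a b with h | h
  · obtain ⟨C, c, -, hc, H⟩ := fMB_bound hq0 hq1 hδ ν L (a := a) (b := b) ha
    exact line_shift ha h hc (fMB_diff hq0 hq1 δ ν L) H
  · obtain ⟨C, c, -, hc, H⟩ := fMB_bound hq0 hq1 hδ ν L (a := b) (b := a) hb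
    exact (line_shift hb h hc (fMB_diff hq0 hq1 δ ν L) H).symm

lemma fMB_int {q : ℝ} (hq0 : 0 < q) (hq1 : q < 1) {δ : ℕ} (hδ : 0 < δ) (ν L : ℝ)
    {a : ℝ} (ha : 0 < a) :
    MeasureTheory.Integrable (fun t : ℝ => fMB q δ ν L ((a : ℂ) + Complex.I * t)) := by
  obtain ⟨C, c, -, hc, H⟩ := fMB_bound hq0 hq1 hδ ν L (a := a) (b := a) ha
  exact line_integrable ha hc (fMB_diff hq0 hq1 δ ν L) fun s hs => H s hs.ge hs.le

lemma gMB_rec {q : ℝ} (hq0 : 0 < q) (hq1 : q < 1) (δ : ℕ) (ν : ℝ) {s : ℂ} (hs : 0 < s.re) :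
    (1 - (q : ℂ) ^ 2) ^ 2 * gMB q δ ν (s + 2) =
      qpow q (2 - δ * s) * (1 - qpow q (s + Complex.I * ν)) * (1 - qpow q (s - Complex.I * ν))
        * gMB q δ ν s := by
  have r1 := qGamma2_rec hq0 hq1 (x := (s + Complex.I * ν) / 2) (by simpa using hs)
  have r2 := qGamma2_rec hq0 hq1 (x := (s - Complex.I * ν) / 2) (by simpa using hs)
  rw [show 2 * ((s + Complex.I * ν) / 2) = s + Complex.I * ν by ring] at r1
  rw [show 2 * ((s - Complex.I * ν) / 2) = s - Complex.I * ν by ring] at r2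
  unfold gMB
  rw [show (s + 2 + Complex.I * ν) / 2 = (s + Complex.I * ν) / 2 + 1 by ring,
    show (s + 2 - Complex.I * ν) / 2 = (s - Complex.I * ν) / 2 + 1 by ring,
    show -((δ : ℂ) * (s + 2) ^ 2 / 4) + (2 + (δ : ℂ)) * (s + 2) / 2 =
      (2 - δ * s) + (-((δ : ℂ) * s ^ 2 / 4) + (2 + (δ : ℂ)) * s / 2) by ring, qpow_add]
  generalize qGamma2 q ((s + Complex.I * ν) / 2 + 1) = A at *
  generalize qGamma2 q ((s - Complex.I * ν) / 2 + 1) = B at *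
  generalize qGamma2 q ((s + Complex.I * ν) / 2) = A' at *
  generalize qGamma2 q ((s - Complex.I * ν) / 2) = B' at *
  generalize qpow q (2 - δ * s) = E
  generalize qpow q (-((δ : ℂ) * s ^ 2 / 4) + (2 + (δ : ℂ)) * s / 2) = F
  linear_combination E * F * (1 - (q : ℂ) ^ 2) * B * r1 +
    E * F * (1 - qpow q (s + Complex.I * ν)) * A' * r2

/-- Pointwise identity behind the q-difference equation. -/
lemma fMB_pointwise {q : ℝ} (hq0 : 0 < q) (hq1 : q < 1) (δ : ℕ) (ν : ℝ) {x : ℝ} (hx : 0 < x)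
    {s : ℂ} (hs : 0 < s.re) :
    fMB q δ ν (Real.log (q⁻¹ * x)) s
      - (qpow q (Complex.I * ν) + qpow q (-(Complex.I * ν))) * fMB q δ ν (Real.log x) s
      + fMB q δ ν (Real.log (q * x)) s =
    qpow q (-(2 * (δ : ℂ))) * (1 - (q : ℂ) ^ 2) ^ 2 * (x : ℂ) ^ 2
      * fMB q δ ν (Real.log (q ^ ((1 : ℝ) - (δ : ℝ)) * x)) (s + 2) := by
  have hg := gMB_rec hq0 hq1 δ ν hs
  have l1 : Real.log (q⁻¹ * x) = -Real.log q + Real.log x := by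
    rw [Real.log_mul (by positivity) hx.ne', Real.log_inv]
  have l2 : Real.log (q * x) = Real.log q + Real.log x := Real.log_mul hq0.ne' hx.ne'
  have l3 : Real.log (q ^ ((1 : ℝ) - (δ : ℝ)) * x) = (1 - δ) * Real.log q + Real.log x := by
    rw [Real.log_mul (by positivity) hx.ne', Real.log_rpow hq0]
  have hxx : (x : ℂ) ^ 2 = Complex.exp (2 * (Real.log x : ℂ)) := by
    rw [show (2 : ℂ) * (Real.log x : ℂ) = Real.log x + Real.log x by ring, Complex.exp_add,
      ← Complex.ofReal_exp, Real.exp_log hx]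
    ring
  rw [l1, l2, l3, hxx]
  unfold fMB
  have hA : Complex.exp (-s * ((-Real.log q + Real.log x : ℝ) : ℂ)) =
      qpow q s * Complex.exp (-s * (Real.log x : ℂ)) := by
    unfold qpow
    rw [← Complex.exp_add]
    push_cast
    ring_nf
  have hB : Complex.exp (-s * ((Real.log q + Real.log x : ℝ) : ℂ)) =
      qpow q (-s) * Complex.exp (-s * (Real.log x : ℂ)) := by
    unfold qpow
    rw [← Complex.exp_add]
    push_cast
    ring_nf
  have hD : qpow q (-(2 * (δ : ℂ))) * Complex.exp (2 * (Real.log x : ℂ)) *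
      Complex.exp (-(s + 2) * (((1 - δ) * Real.log q + Real.log x : ℝ) : ℂ)) =
      qpow q (-2 + δ * s - s) * Complex.exp (-s * (Real.log x : ℂ)) := by
    unfold qpow
    rw [← Complex.exp_add, ← Complex.exp_add, ← Complex.exp_add]
    push_cast
    ring_nf
  have hP : qpow q (-2 + δ * s - s) * (qpow q (2 - δ * s) * (1 - qpow q (s + Complex.I * ν)) *
      (1 - qpow q (s - Complex.I * ν))) =
      qpow q s - (qpow q (Complex.I * ν) + qpow q (-(Complex.I * ν))) + qpow q (-s) := by
    rw [← mul_assoc, ← mul_assoc, ← qpow_add,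
      show -2 + δ * s - s + (2 - δ * s) = -s by ring, sub_eq_add_neg s, qpow_add, qpow_add]
    have h1 : qpow q (-s) * qpow q s = 1 := by rw [← qpow_add]; simp [qpow]
    have h2 : qpow q (Complex.I * ν) * qpow q (-(Complex.I * ν)) = 1 := by
      rw [← qpow_add]; simp [qpow]
    linear_combination (-qpow q (Complex.I * ν) - qpow q (-(Complex.I * ν))
      + qpow q s * qpow q (Complex.I * ν) * qpow q (-(Complex.I * ν))) * h1 + qpow q s * h2
  rw [hA, hB]
  calc _ = gMB q δ ν s * Complex.exp (-s * (Real.log x : ℂ)) *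
        (qpow q s - (qpow q (Complex.I * ν) + qpow q (-(Complex.I * ν))) + qpow q (-s)) := by ring
    _ = (qpow q (-2 + δ * s - s) * Complex.exp (-s * (Real.log x : ℂ))) *
        ((1 - (q : ℂ) ^ 2) ^ 2 * gMB q δ ν (s + 2)) := by rw [hg, ← hP]; ring
    _ = _ := by rw [← hD]; ring

/-- For `δ ∈ {1,2}` the Mellin–Barnes integral `G(x)` converges absolutely for
every `x > 0`, is independent of the choice of `σ > 0`, and satisfies the
two-body relativistic open Toda q-difference equation
`G(q⁻¹x) − (q^{iν}+q^{−iν})G(x) + G(qx) − q^{−2δ}(1−q²)²x²G(q^{1−δ}x) = 0`. -/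
theorem GMB_toda_solution (q : ℝ) (hq0 : 0 < q) (hq1 : q < 1)
    (δ : ℕ) (hδ : δ = 1 ∨ δ = 2) (ν : ℝ) (σ : ℝ) (hσ : 0 < σ) :
    (∀ x : ℝ, 0 < x →
      MeasureTheory.Integrable (fun t : ℝ =>
        gMB q δ ν ((σ : ℂ) + Complex.I * t)
          * Complex.exp (-((σ : ℂ) + Complex.I * t) * (Real.log x : ℂ)))) ∧
    (∀ σ' : ℝ, 0 < σ' → ∀ x : ℝ, 0 < x → GMB q δ ν σ x = GMB q δ ν σ' x) ∧
    (∀ x : ℝ, 0 < x →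
      GMB q δ ν σ (q⁻¹ * x)
        - (qpow q (Complex.I * ν) + qpow q (-(Complex.I * ν))) * GMB q δ ν σ x
        + GMB q δ ν σ (q * x)
        - qpow q (-(2 * (δ : ℂ))) * (1 - (q : ℂ) ^ 2) ^ 2 * (x : ℂ) ^ 2
            * GMB q δ ν σ (q ^ ((1 : ℝ) - (δ : ℝ)) * x) = 0) := by
  have hδ0 : 0 < δ := by omega
  refine ⟨fun x _ => fMB_int hq0 hq1 hδ0 ν (Real.log x) hσ, fun σ' hσ' x _ => ?_, fun x hx => ?_⟩
  · unfold GMB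
    congr 1
    exact fMB_shift hq0 hq1 hδ0 ν (Real.log x) hσ hσ'
  · have hG : ∀ τ y, GMB q δ ν τ y = (1 / (2 * (Real.pi : ℂ))) *
        ∫ t : ℝ, fMB q δ ν (Real.log y) ((τ : ℂ) + Complex.I * t) := fun τ y => rfl
    simp only [hG]
    set y := q ^ ((1 : ℝ) - (δ : ℝ)) * x with hy
    have hsh := fMB_shift hq0 hq1 hδ0 ν (Real.log y) hσ (b := σ + 2) (by linarith)
    have i1 := fMB_int hq0 hq1 hδ0 ν (Real.log (q⁻¹ * x)) hσ
    have i2 := fMB_int hq0 hq1 hδ0 ν (Real.log x) hσ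
    have i3 := fMB_int hq0 hq1 hδ0 ν (Real.log (q * x)) hσ
    have main : (∫ t : ℝ, fMB q δ ν (Real.log (q⁻¹ * x)) ((σ : ℂ) + Complex.I * t))
        - (qpow q (Complex.I * ν) + qpow q (-(Complex.I * ν))) *
          (∫ t : ℝ, fMB q δ ν (Real.log x) ((σ : ℂ) + Complex.I * t))
        + (∫ t : ℝ, fMB q δ ν (Real.log (q * x)) ((σ : ℂ) + Complex.I * t)) =
        qpow q (-(2 * (δ : ℂ))) * (1 - (q : ℂ) ^ 2) ^ 2 * (x : ℂ) ^ 2 *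
          ∫ t : ℝ, fMB q δ ν (Real.log y) (((σ + 2 : ℝ) : ℂ) + Complex.I * t) := by
      rw [← MeasureTheory.integral_const_mul, ← MeasureTheory.integral_const_mul,
        ← MeasureTheory.integral_sub i1 (i2.const_mul _),
        ← MeasureTheory.integral_add (by exact i1.sub (i2.const_mul _)) i3]
      refine MeasureTheory.integral_congr_ae (.of_forall fun t => ?_)
      have := fMB_pointwise hq0 hq1 δ ν hx (s := (σ : ℂ) + Complex.I * t) (by simpa using hσ)
      simp only [hy]
      rw [show ((σ + 2 : ℝ) : ℂ) + Complex.I * t = (σ : ℂ) + Complex.I * t + 2 by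
        push_cast; ring]
      exact this
    rw [hsh]
    linear_combination (1 / (2 * (Real.pi : ℂ))) * main
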